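/- Let A and B be types of L^∘ such that the sequent A → B is derivable in L^∘, and such that for all sequences of types Γ and Δ, if Γ,Δ → B is derivable in L^∘ then Δ,Γ → B is derivable in L^∘. Then the sequent A^∘ → B is derivable in L^∘. -/

import Mathlib

/-- Types of the Lambek calculus with the cyclic shift `L^∘`, built from
primitive types `P` by `\` (`ldiv A B = A \ B`), `/` (`rdiv B A = B / A`),
`·` (`mul`) and the cyclic shift `^∘` (`circ`). -/
inductive Fm (P : Type) : Type
  | prim : P → Fm P
  | ldiv : Fm P → Fm P → Fm P
  | rdiv : Fm P → Fm P → Fm P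
  | mul  : Fm P → Fm P → Fm P
  | circ : Fm P → Fm P
deriving DecidableEq

open Fm

/-- Derivability of sequents in the Lambek calculus with the cyclic shift `L^∘`.
The Boolean flag indicates whether the rule (cut) may be used:
`Dv P true` is `L^∘` (with cut), `Dv P false` is its cut-free part. -/
inductive Dv (P : Type) : Bool → List (Fm P) → Fm P → Prop
  | ax (c : Bool) (A : Fm P) :
      Dv P c [A] A
  | ldivL (c : Bool) (Γ Δ Pi : List (Fm P)) (A B C : Fm P) :
      Dv P c (Γ ++ B :: Δ) C → Dv P c Pi A → Pi ≠ [] →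
      Dv P c (Γ ++ Pi ++ ldiv A B :: Δ) C
  | ldivR (c : Bool) (Pi : List (Fm P)) (A B : Fm P) :
      Dv P c (A :: Pi) B → Pi ≠ [] →
      Dv P c Pi (ldiv A B)
  | rdivL (c : Bool) (Γ Δ Pi : List (Fm P)) (A B C : Fm P) :
      Dv P c (Γ ++ B :: Δ) C → Dv P c Pi A → Pi ≠ [] →
      Dv P c (Γ ++ rdiv B A :: (Pi ++ Δ)) C
  | rdivR (c : Bool) (Pi : List (Fm P)) (A B : Fm P) :
      Dv P c (Pi ++ [A]) B → Pi ≠ [] →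
      Dv P c Pi (rdiv B A)
  | mulL (c : Bool) (Γ Δ : List (Fm P)) (A B C : Fm P) :
      Dv P c (Γ ++ A :: B :: Δ) C →
      Dv P c (Γ ++ mul A B :: Δ) C
  | mulR (c : Bool) (Pi Psi : List (Fm P)) (A B : Fm P) :
      Dv P c Pi A → Dv P c Psi B → Pi ≠ [] → Psi ≠ [] →
      Dv P c (Pi ++ Psi) (mul A B)
  | circR (c : Bool) (Pi : List (Fm P)) (A : Fm P) :
      Dv P c Pi A →
      Dv P c Pi (circ A)
  | circL (c : Bool) (A B : Fm P) :
      Dv P c [B] (circ A) →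
      Dv P c [circ B] (circ A)
  | circC (c : Bool) (Pi Psi : List (Fm P)) (A : Fm P) :
      Dv P c (Pi ++ Psi) (circ A) → Pi ≠ [] → Psi ≠ [] →
      Dv P c (Psi ++ Pi) (circ A)
  | cut (Γ Δ Pi : List (Fm P)) (A B : Fm P) :
      Dv P true Pi A → Dv P true (Γ ++ A :: Δ) B → Pi ≠ [] →
      Dv P true (Γ ++ Pi ++ Δ) B

namespace CircProof

open Fm

variable {P : Type}

theorem dv_ne {c : Bool} {S : List (Fm P)} {X : Fm P} (h : Dv P c S X) : S ≠ [] := by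
  induction h <;> simp_all

/-! ### Cut elimination, by a phase-semantics argument -/

def val : Fm P → List (Fm P) → Prop
  | prim p, w => Dv P false w (prim p)
  | ldiv A B, w => w ≠ [] ∧ ∀ x, val A x → val B (x ++ w)
  | rdiv B A, w => w ≠ [] ∧ ∀ x, val A x → val B (w ++ x)
  | mul A B, w => ∀ (G D : List (Fm P)) (C : Fm P),
      (∀ x y, val A x → val B y → Dv P false (G ++ x ++ y ++ D) C) → Dv P false (G ++ w ++ D) C
  | circ A, w => ∀ C : Fm P, (∀ x, val A x → Dv P false x (circ C)) → Dv P false w (circ C)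

theorem val_closed (A : Fm P) : ∀ w : List (Fm P), w ≠ [] →
    (∀ (G D : List (Fm P)) (C : Fm P),
      (∀ x, val A x → Dv P false (G ++ x ++ D) C) → Dv P false (G ++ w ++ D) C) → val A w := by
  induction A with
  | prim p =>
    intro w _ h
    have := h [] [] (prim p) (by intro x hx; simpa [val] using hx)
    simpa [val] using this
  | ldiv A B _ ihB =>
    intro w hw h
    refine ⟨hw, fun x hx => ihB _ (by simp [hw]) ?_⟩
    intro G D C hC
    have := h (G ++ x) D C (by
      intro z hz
      have := hC _ (hz.2 x hx)
      simpa using this)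
    simpa using this
  | rdiv B A ihB _ =>
    intro w hw h
    refine ⟨hw, fun x hx => ihB _ (by simp [hw]) ?_⟩
    intro G D C hC
    have := h G (x ++ D) C (by
      intro z hz
      have := hC _ (hz.2 x hx)
      simpa using this)
    simpa using this
  | mul A B _ _ =>
    intro w _ h G D C hC
    exact h G D C (fun z hz => hz G D C hC)
  | circ A _ =>
    intro w _ h C hC
    have := h [] [] (circ C) (by
      intro z hz
      have := hz C hC
      simpa using this)
    simpa using this

theorem truth (A : Fm P) : val A [A] ∧ ∀ w, val A w → Dv P false w A := by
  induction A with
  | prim p => exact ⟨Dv.ax _ _, fun w h => h⟩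
  | ldiv A B ihA ihB =>
    refine ⟨⟨by simp, fun x hx => val_closed B _ (by simp) ?_⟩, ?_⟩
    · intro G D C hC
      have h1 := hC _ ihB.1
      have h2 := ihA.2 x hx
      have := Dv.ldivL false G D x A B C (by simpa using h1) h2 (dv_ne h2)
      simpa using this
    · intro w hw
      exact Dv.ldivR _ _ _ _ (ihB.2 _ (hw.2 _ ihA.1)) hw.1
  | rdiv B A ihB ihA =>
    refine ⟨⟨by simp, fun x hx => val_closed B _ (by simp) ?_⟩, ?_⟩
    · intro G D C hC
      have h1 := hC _ ihB.1
      have h2 := ihA.2 x hx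
      have := Dv.rdivL false G D x A B C (by simpa using h1) h2 (dv_ne h2)
      simpa using this
    · intro w hw
      exact Dv.rdivR _ _ _ _ (ihB.2 _ (hw.2 _ ihA.1)) hw.1
  | mul A B ihA ihB =>
    refine ⟨?_, ?_⟩
    · intro G D C hC
      have h1 := hC _ _ ihA.1 ihB.1
      have := Dv.mulL false G D A B C (by simpa using h1)
      simpa using this
    · intro w hw
      have := hw [] [] (mul A B) (by
        intro x y hx hy
        have h1 := ihA.2 x hx
        have h2 := ihB.2 y hy
        simpa using Dv.mulR false x y A B h1 h2 (dv_ne h1) (dv_ne h2))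
      simpa using this
  | circ A ihA =>
    refine ⟨?_, ?_⟩
    · intro C hC
      exact Dv.circL _ _ _ (hC _ ihA.1)
    · intro w hw
      exact hw A (fun x hx => Dv.circR _ _ _ (ihA.2 x hx))

def valS : List (Fm P) → List (Fm P) → Prop
  | [], w => w = []
  | A :: G, w => ∃ x y, w = x ++ y ∧ val A x ∧ valS G y

theorem valS_append (G D : List (Fm P)) : ∀ w, valS (G ++ D) w ↔
    ∃ x y, w = x ++ y ∧ valS G x ∧ valS D y := by
  induction G with
  | nil => intro w; simp [valS]
  | cons A G ih =>
    intro w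
    constructor
    · rintro ⟨x, y, rfl, hx, hy⟩
      obtain ⟨y1, y2, rfl, h1, h2⟩ := (ih y).1 hy
      exact ⟨x ++ y1, y2, by simp, ⟨x, y1, rfl, hx, h1⟩, h2⟩
    · rintro ⟨_, y, rfl, ⟨x1, x2, rfl, h1, h2⟩, hy⟩
      exact ⟨x1, x2 ++ y, by simp, h1, (ih _).2 ⟨x2, y, rfl, h2, hy⟩⟩

theorem val_ne {A : Fm P} {w : List (Fm P)} (h : val A w) : w ≠ [] := dv_ne ((truth A).2 w h)

theorem valS_ne {G w : List (Fm P)} (hG : G ≠ []) (h : valS G w) : w ≠ [] := by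
  cases G with
  | nil => exact absurd rfl hG
  | cons A G =>
    obtain ⟨x, y, rfl, hx, _⟩ := h
    simp [val_ne hx]

theorem valS_self (G : List (Fm P)) : valS G G := by
  induction G with
  | nil => rfl
  | cons A G ih => exact ⟨[A], G, rfl, (truth A).1, ih⟩

theorem valS_single (A : Fm P) (w : List (Fm P)) : valS [A] w ↔ val A w := by
  simp [valS]

theorem sound {c : Bool} {S : List (Fm P)} {X : Fm P} (h : Dv P c S X) :
    ∀ w, valS S w → val X w := by
  induction h with
  | ax c A => intro w hw; exact (valS_single _ _).1 hw
  | ldivL c Γ Δ Pi A B C _ _ _ ih1 ih2 =>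
    intro w hw
    obtain ⟨_, _, rfl, h1, h2⟩ := (valS_append _ _ _).1 hw
    obtain ⟨g, p, rfl, hg, hp⟩ := (valS_append _ _ _).1 h1
    obtain ⟨l, d, rfl, hl, hd⟩ := h2
    have := ih1 (g ++ ((p ++ l) ++ d)) ((valS_append _ _ _).2
      ⟨g, _, rfl, hg, ⟨p ++ l, d, rfl, hl.2 p (ih2 p hp), hd⟩⟩)
    simpa using this
  | ldivR c Pi A B _ hne ih =>
    intro w hw
    exact ⟨valS_ne hne hw, fun x hx => ih _ ⟨x, w, rfl, hx, hw⟩⟩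
  | rdivL c Γ Δ Pi A B C _ _ _ ih1 ih2 =>
    intro w hw
    obtain ⟨g, _, rfl, hg, h2⟩ := (valS_append _ _ _).1 hw
    obtain ⟨l, _, rfl, hl, h3⟩ := h2
    obtain ⟨p, d, rfl, hp, hd⟩ := (valS_append _ _ _).1 h3
    have := ih1 (g ++ ((l ++ p) ++ d)) ((valS_append _ _ _).2
      ⟨g, _, rfl, hg, ⟨l ++ p, d, rfl, hl.2 p (ih2 p hp), hd⟩⟩)
    simpa using this
  | rdivR c Pi A B _ hne ih =>
    intro w hw
    exact ⟨valS_ne hne hw, fun x hx => ih _ ((valS_append _ _ _).2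
      ⟨w, x, rfl, hw, (valS_single _ _).2 hx⟩)⟩
  | mulL c Γ Δ A B C _ ih =>
    intro w hw
    have hw0 := valS_ne (by simp) hw
    obtain ⟨g, _, rfl, hg, h2⟩ := (valS_append _ _ _).1 hw
    obtain ⟨m, d, rfl, hm, hd⟩ := h2
    refine val_closed C _ hw0 ?_
    intro G D C' hC
    have := hm (G ++ g) (d ++ D) C' (by
      intro x y hx hy
      have := hC _ (ih (g ++ (x ++ (y ++ d))) ((valS_append _ _ _).2
        ⟨g, _, rfl, hg, x, _, rfl, hx, y, d, rfl, hy, hd⟩))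
      simpa using this)
    simpa using this
  | mulR c Pi Psi A B _ _ _ _ ih1 ih2 =>
    intro w hw
    obtain ⟨p, s, rfl, hp, hs⟩ := (valS_append _ _ _).1 hw
    intro G D C hC
    have := hC p s (ih1 p hp) (ih2 s hs)
    simpa using this
  | circR c Pi A _ ih =>
    intro w hw C hC
    exact hC w (ih w hw)
  | circL c A B _ ih =>
    intro w hw C hC
    have hw' := (valS_single _ _).1 hw
    exact hw' C (fun x hx => ih x ((valS_single _ _).2 hx) C hC)
  | circC c Pi Psi A _ h1 h2 ih =>
    intro w hw C hC
    obtain ⟨s, p, rfl, hs, hp⟩ := (valS_append _ _ _).1 hw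
    exact Dv.circC _ _ _ _ (ih (p ++ s) ((valS_append _ _ _).2 ⟨p, s, rfl, hp, hs⟩) C hC)
      (valS_ne h1 hp) (valS_ne h2 hs)
  | cut Γ Δ Pi A B _ _ _ ih1 ih2 =>
    intro w hw
    obtain ⟨_, d, rfl, h1, hd⟩ := (valS_append _ _ _).1 hw
    obtain ⟨g, p, rfl, hg, hp⟩ := (valS_append _ _ _).1 h1
    have := ih2 (g ++ (p ++ d)) ((valS_append _ _ _).2 ⟨g, _, rfl, hg, p, d, rfl, ih1 p hp, hd⟩)
    simpa using this

theorem cut_elim {c : Bool} {S : List (Fm P)} {X : Fm P} (h : Dv P c S X) : Dv P false S X :=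
  (truth X).2 S (sound h S (valS_self S))

theorem to_true {c : Bool} {S : List (Fm P)} {X : Fm P} (h : Dv P c S X) : Dv P true S X := by
  induction h with
  | ax c A => exact Dv.ax _ _
  | ldivL c Γ Δ Pi A B C _ _ h ih1 ih2 => exact Dv.ldivL _ _ _ _ _ _ _ ih1 ih2 h
  | ldivR c Pi A B _ h ih => exact Dv.ldivR _ _ _ _ ih h
  | rdivL c Γ Δ Pi A B C _ _ h ih1 ih2 => exact Dv.rdivL _ _ _ _ _ _ _ ih1 ih2 h
  | rdivR c Pi A B _ h ih => exact Dv.rdivR _ _ _ _ ih h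
  | mulL c Γ Δ A B C _ ih => exact Dv.mulL _ _ _ _ _ _ ih
  | mulR c Pi Psi A B _ _ h1 h2 ih1 ih2 => exact Dv.mulR _ _ _ _ _ ih1 ih2 h1 h2
  | circR c Pi A _ ih => exact Dv.circR _ _ _ ih
  | circL c A B _ ih => exact Dv.circL _ _ _ ih
  | circC c Pi Psi A _ h1 h2 ih => exact Dv.circC _ _ _ _ ih h1 h2
  | cut Γ Δ Pi A B _ _ h ih1 ih2 => exact Dv.cut _ _ _ _ _ ih1 ih2 h

/-! ### Counting -/

def sz : Fm P → ℕ
  | prim _ => 1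
  | ldiv A B => sz A + sz B
  | rdiv B A => sz B + sz A
  | mul A B => sz A + sz B
  | circ A => sz A

def cnt : Fm P → ℤ
  | prim _ => 1
  | ldiv A B => cnt B - cnt A
  | rdiv B A => cnt B - cnt A
  | mul A B => cnt A + cnt B
  | circ A => cnt A

theorem sz_pos (A : Fm P) : 1 ≤ sz A := by
  induction A <;> simp only [sz] <;> omega

theorem cnt_le (A : Fm P) : cnt A ≤ sz A ∧ -(sz A : ℤ) ≤ cnt A := by
  induction A with
  | prim p => simp [sz, cnt]
  | circ A ih => simpa only [sz, cnt] using ih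
  | _ A B ih1 ih2 => simp only [sz, cnt]; push_cast; omega

theorem balance {c : Bool} {S : List (Fm P)} {X : Fm P} (h : Dv P c S X) :
    (S.map cnt).sum = cnt X := by
  induction h <;> simp [cnt] at * <;> linarith

def atom : Fm P → P
  | prim p => p
  | ldiv A _ => atom A
  | rdiv B _ => atom B
  | mul A _ => atom A
  | circ A => atom A

def pw (p : P) : ℕ → Fm P
  | 0 => prim p
  | k + 1 => mul (prim p) (pw p k)

theorem cnt_pw (p : P) (k : ℕ) : cnt (pw p k) = k + 1 := by
  induction k with
  | zero => simp [pw, cnt]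
  | succ k ih => simp [pw, cnt, ih]; ring

/-! ### Marked sequents -/

inductive Sym (P : Type) : Type
  | nm : Fm P → Sym P
  | q : Sym P
  | r : Sym P

open CircProof.Sym

/-- the formula marked by a symbol -/
def ev (p : P) (N : ℕ) (B : Fm P) : Sym P → Fm P
  | nm F => F
  | q => circ (pw p N)
  | r => ldiv (circ (pw p N)) B

def rho (I : Fm P) : Sym P → List (Fm P)
  | nm F => [F]
  | q => []
  | r => [I]

def s1 : Sym P → ℕ
  | nm F => sz F
  | q => 0
  | r => 0
def q1 : Sym P → ℕ
  | nm _ => 0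
  | q => 1
  | r => 0
def r1 : Sym P → ℕ
  | nm _ => 0
  | q => 0
  | r => 1

def size (L : List (Sym P)) : ℕ := (L.map s1).sum
def nq (L : List (Sym P)) : ℕ := (L.map q1).sum
def nr (L : List (Sym P)) : ℕ := (L.map r1).sum

@[simp] theorem size_nil : size ([] : List (Sym P)) = 0 := rfl
@[simp] theorem nq_nil : nq ([] : List (Sym P)) = 0 := rfl
@[simp] theorem nr_nil : nr ([] : List (Sym P)) = 0 := rfl
@[simp] theorem size_cons (s : Sym P) (L) : size (s :: L) = s1 s + size L := by simp [size]
@[simp] theorem nq_cons (s : Sym P) (L) : nq (s :: L) = q1 s + nq L := by simp [nq]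
@[simp] theorem nr_cons (s : Sym P) (L) : nr (s :: L) = r1 s + nr L := by simp [nr]
@[simp] theorem size_append (K L : List (Sym P)) : size (K ++ L) = size K + size L := by
  simp [size]
@[simp] theorem nq_append (K L : List (Sym P)) : nq (K ++ L) = nq K + nq L := by simp [nq]
@[simp] theorem nr_append (K L : List (Sym P)) : nr (K ++ L) = nr K + nr L := by simp [nr]

theorem cnt_marked (p : P) (N : ℕ) (B : Fm P) (L : List (Sym P)) :
    ∃ z : ℤ, z ≤ size L ∧ -(size L : ℤ) ≤ z ∧
      ((L.map (ev p N B)).map cnt).sum = (N + 1) * nq L + (cnt B - (N + 1)) * nr L + z := by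
  induction L with
  | nil => exact ⟨0, by simp⟩
  | cons s L ih =>
    obtain ⟨z, h1, h2, h3⟩ := ih
    cases s with
    | nm F =>
      have := cnt_le F
      refine ⟨cnt F + z, ?_, ?_, ?_⟩
      · simp [s1]; omega
      · simp [s1]; omega
      · simp only [List.map_cons, List.sum_cons, h3, ev, nq_cons, nr_cons, q1, r1]; push_cast; ring
    | q =>
      refine ⟨z, ?_, ?_, ?_⟩
      · simpa [s1] using h1
      · simpa [s1] using h2
      · simp only [List.map_cons, List.sum_cons, h3, ev, nq_cons, nr_cons, q1, r1, cnt, cnt_pw]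
        push_cast; ring
    | r =>
      refine ⟨z, ?_, ?_, ?_⟩
      · simpa [s1] using h1
      · simpa [s1] using h2
      · simp only [List.map_cons, List.sum_cons, h3, ev, nq_cons, nr_cons, q1, r1, cnt, cnt_pw]
        push_cast; ring

theorem bal {p : P} {N : ℕ} {B : Fm P} {c : Bool} {L : List (Sym P)} {X : Fm P}
    (h : Dv P c (L.map (ev p N B)) X) (hs : size L + sz X + sz B ≤ N)
    (hq : nq L ≤ 1) (hr : nr L ≤ 1) : nq L = nr L := by
  obtain ⟨z, h1, h2, h3⟩ := cnt_marked p N B L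
  rw [balance h] at h3
  have := cnt_le X
  have := cnt_le B
  rcases Nat.le_one_iff_eq_zero_or_eq_one.1 hq with h4 | h4 <;>
  rcases Nat.le_one_iff_eq_zero_or_eq_one.1 hr with h5 | h5 <;>
  rw [h4, h5] at h3 <;> push_cast at h3 <;> omega

theorem balD {p : P} {N : ℕ} {B : Fm P} {c : Bool} {L : List (Sym P)}
    (h : Dv P c (L.map (ev p N B)) (circ (pw p N))) (hs : size L ≤ N)
    (hr : nr L = 0) : nq L ≠ 0 := by
  obtain ⟨z, h1, h2, h3⟩ := cnt_marked p N B L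
  rw [balance h] at h3
  intro h4
  rw [h4, hr] at h3
  simp only [cnt, cnt_pw] at h3
  push_cast at h3
  omega

/-- `Γ, D, Δ → D` forces `Γ, Δ` empty -/
theorem only_q {p : P} {N : ℕ} {B : Fm P} {c : Bool} {S : List (Fm P)} {F : Fm P}
    (h : Dv P c S F) : c = false → ∀ L : List (Sym P), S = L.map (ev p N B) →
    nq L = 1 → nr L = 0 → size L + sz B ≤ N →
    (∀ k, F ≠ pw p k) ∧ (F = circ (pw p N) → L = [q]) := by
  induction h with
  | ax c A =>
    intro _ L hL hq hr hs
    obtain ⟨s, L', rfl, h1, h2⟩ := List.map_eq_cons_iff.1 hL.symm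
    obtain rfl := List.map_eq_nil_iff.1 h2
    cases s with
    | nm F => simp [q1] at hq
    | r => simp [q1] at hq
    | q =>
      refine ⟨?_, fun _ => rfl⟩
      intro k hk
      rw [hk] at h1
      cases k <;> simp [ev, pw] at h1
  | ldivL c Γ Δ Pi A B' C h1 h2 hne ih1 ih2 =>
    intro hc L hL hq hr hs
    obtain ⟨L12, L3', rfl, h3, h4⟩ := List.map_eq_append_iff.1 hL.symm
    obtain ⟨L1, L2, rfl, rfl, rfl⟩ := List.map_eq_append_iff.1 h3
    obtain ⟨s, L3, rfl, h5, rfl⟩ := List.map_eq_cons_iff.1 h4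
    cases s with
    | q => simp [ev] at h5
    | r => simp [r1] at hr
    | nm F =>
      simp only [ev] at h5; subst h5
      simp [q1, r1, s1, sz] at hq hr hs
      have hb := bal h2 (by omega) (by omega) (by omega)
      have := ih1 hc (L1 ++ nm B' :: L3) (by simp [ev]) (by simp [q1]; omega)
        (by simp [r1]; omega) (by simp [s1]; omega)
      refine ⟨this.1, fun hF => ?_⟩
      have := this.2 hF
      cases L1 <;> simp at this
  | rdivL c Γ Δ Pi A B' C h1 h2 hne ih1 ih2 =>
    intro hc L hL hq hr hs
    obtain ⟨L1, L3', rfl, rfl, h4⟩ := List.map_eq_append_iff.1 hL.symm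
    obtain ⟨s, L23, rfl, h5, h3⟩ := List.map_eq_cons_iff.1 h4
    obtain ⟨L2, L3, rfl, rfl, rfl⟩ := List.map_eq_append_iff.1 h3
    cases s with
    | q => simp [ev] at h5
    | r => simp [r1] at hr
    | nm F =>
      simp only [ev] at h5; subst h5
      simp [q1, r1, s1, sz] at hq hr hs
      have hb := bal h2 (by omega) (by omega) (by omega)
      have := ih1 hc (L1 ++ nm B' :: L3) (by simp [ev]) (by simp [q1]; omega)
        (by simp [r1]; omega) (by simp [s1]; omega)
      refine ⟨this.1, fun hF => ?_⟩
      have := this.2 hF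
      cases L1 <;> simp at this
  | ldivR c Pi A B' h1 hne ih =>
    intro hc L hL hq hr hs
    exact ⟨fun k => by cases k <;> simp [pw], fun h => by simp at h⟩
  | rdivR c Pi A B' h1 hne ih =>
    intro hc L hL hq hr hs
    exact ⟨fun k => by cases k <;> simp [pw], fun h => by simp at h⟩
  | mulL c Γ Δ A B' C h1 ih =>
    intro hc L hL hq hr hs
    obtain ⟨L1, L3', rfl, rfl, h4⟩ := List.map_eq_append_iff.1 hL.symm
    obtain ⟨s, L3, rfl, h5, rfl⟩ := List.map_eq_cons_iff.1 h4
    cases s with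
    | q => simp [ev] at h5
    | r => simp [r1] at hr
    | nm F =>
      simp only [ev] at h5; subst h5
      simp [q1, r1, s1, sz] at hq hr hs
      have := ih hc (L1 ++ nm A :: nm B' :: L3) (by simp [ev]) (by simp [q1]; omega)
        (by simp [r1]; omega) (by simp [s1]; omega)
      refine ⟨this.1, fun hF => ?_⟩
      have := this.2 hF
      cases L1 <;> simp at this
  | mulR c Pi Psi A B' h1 h2 _ _ ih1 ih2 =>
    intro hc L hL hq hr hs
    obtain ⟨L1, L2, rfl, rfl, rfl⟩ := List.map_eq_append_iff.1 hL.symm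
    refine ⟨?_, fun h => by simp at h⟩
    intro k hk
    simp at hq hr hs
    cases k with
    | zero => simp [pw] at hk
    | succ k =>
      simp only [pw, Fm.mul.injEq] at hk
      by_cases h : nq L1 = 1
      · exact (ih1 hc L1 rfl h (by omega) (by omega)).1 0 hk.1
      · exact (ih2 hc L2 rfl (by omega) (by omega) (by omega)).1 k hk.2
  | circR c Pi A h1 ih =>
    intro hc L hL hq hr hs
    refine ⟨fun k => by cases k <;> simp [pw], fun h => ?_⟩
    simp only [Fm.circ.injEq] at h
    exact absurd h ((ih hc L hL hq hr hs).1 N)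
  | circL c A B' h1 ih =>
    intro hc L hL hq hr hs
    refine ⟨fun k => by cases k <;> simp [pw], fun h => ?_⟩
    obtain ⟨s, L', rfl, h1, h2⟩ := List.map_eq_cons_iff.1 hL.symm
    obtain rfl := List.map_eq_nil_iff.1 h2
    cases s with
    | nm F => simp [q1] at hq
    | r => simp [q1] at hq
    | q => rfl
  | circC c Pi Psi A h1 hn1 hn2 ih =>
    intro hc L hL hq hr hs
    refine ⟨fun k => by cases k <;> simp [pw], fun h => ?_⟩
    obtain ⟨L1, L2, rfl, rfl, rfl⟩ := List.map_eq_append_iff.1 hL.symm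
    simp at hq hr hs
    have := (ih hc (L2 ++ L1) (by simp) (by simp; omega) (by simp; omega)
      (by simp; omega)).2 h
    have := congrArg List.length this
    have h3 := List.length_pos_iff.2 hn1
    have h4 := List.length_pos_iff.2 hn2
    simp only [List.length_map, List.length_append, List.length_cons, List.length_nil] at this h3 h4
    omega
  | cut => intro hc; simp at hc

/-- residual of a context -/
theorem resid (B : Fm P) (G : List (Fm P)) : ∀ (T : List (Fm P)) (X : Fm P),
    Dv P true (G ++ B :: T) X →
    ∃ I, Dv P true [B] I ∧ Dv P true (G ++ I :: T) X ∧
      sz I = (G.map sz).sum + (T.map sz).sum + sz X := by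
  intro T
  induction T using List.reverseRecOn with
  | nil =>
    induction G with
    | nil =>
      intro X h
      exact ⟨X, h, Dv.ax _ _, by simp⟩
    | cons A G ih =>
      intro X h
      obtain ⟨I, h1, h2, h3⟩ := ih (ldiv A X) (Dv.ldivR _ _ _ _ h (by simp))
      refine ⟨I, h1, ?_, by simp [sz] at *; omega⟩
      have h4 : Dv P true [A, ldiv A X] X :=
        Dv.ldivL true [] [] [A] A X X (Dv.ax _ _) (Dv.ax _ _) (by simp)
      have := Dv.cut [A] [] _ _ _ h2 h4 (by simp)
      simpa using this
  | append_singleton T A ih =>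
    intro X h
    obtain ⟨I, h1, h2, h3⟩ := ih (rdiv X A) (Dv.rdivR _ _ _ _ (by simpa using h) (by simp))
    refine ⟨I, h1, ?_, by simp [sz] at *; omega⟩
    have h4 : Dv P true [rdiv X A, A] X :=
      Dv.rdivL true [] [] [A] A X X (Dv.ax _ _) (Dv.ax _ _) (by simp)
    have := Dv.cut [] [A] _ _ _ h2 h4 (by simp)
    simpa using this

theorem plain (p : P) (N : ℕ) (B I : Fm P) (L : List (Sym P)) (hq : nq L = 0) (hr : nr L = 0) :
    L.flatMap (rho I) = L.map (ev p N B) ∧ ((L.map (ev p N B)).map sz).sum = size L := by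
  induction L with
  | nil => simp
  | cons s L ih =>
    cases s with
    | q => simp [q1] at hq
    | r => simp [r1] at hr
    | nm F =>
      simp [q1, r1] at hq hr
      have := ih hq hr
      simp_all [rho, ev, s1]

def Tight (L : List (Sym P)) (X : Fm P) : Prop :=
  (∃ G T, L = G ++ q :: r :: T) ∨ ((∃ C, X = circ C) ∧ ∃ M, L = r :: M ++ [q])

theorem tight_ldivR {L : List (Sym P)} {A X Y : Fm P} (h : Tight (nm A :: L) X) : Tight L Y := by
  rcases h with ⟨G, T, h⟩ | ⟨_, M, h⟩
  · cases G with
    | nil => simp at h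
    | cons a G => exact Or.inl ⟨G, T, by simpa using (List.cons.inj h).2⟩
  · simp at h

theorem tight_rdivR {L : List (Sym P)} {A X Y : Fm P} (h : Tight (L ++ [nm A]) X) : Tight L Y := by
  rcases h with ⟨G, T, h⟩ | ⟨_, M, h⟩
  · induction T using List.reverseRecOn with
    | nil =>
      have : L ++ [nm A] = (G ++ [q]) ++ [r] := by simpa using h
      have := (List.append_inj' this rfl).2
      simp at this
    | append_singleton T a _ =>
      have : L ++ [nm A] = (G ++ q :: r :: T) ++ [a] := by simpa using h
      exact Or.inl ⟨G, T, (List.append_inj' this rfl).1⟩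
  · have := (List.append_inj' h rfl).2
    simp at this

theorem tight_mulL {L K : List (Sym P)} {A B X : Fm P} (Z : Fm P)
    (h : Tight (L ++ nm A :: nm B :: K) X) : Tight (L ++ nm Z :: K) X := by
  rcases h with ⟨G, T, h⟩ | ⟨hX, M, h⟩
  · left
    rcases List.append_eq_append_iff.1 h with ⟨a, rfl, h2⟩ | ⟨a, rfl, h2⟩
    · rcases a with _ | ⟨a1, _ | ⟨a2, a⟩⟩
      · simp at h2
      · simp at h2
      · simp at h2
        exact ⟨L ++ nm Z :: a, T, by simp [h2.2.2]⟩
    · rcases a with _ | ⟨a1, _ | ⟨a2, a⟩⟩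
      · simp at h2
      · simp at h2
      · simp at h2
        obtain ⟨rfl, rfl, rfl⟩ := h2
        exact ⟨G, a ++ nm Z :: K, by simp⟩
  · right
    refine ⟨hX, ?_⟩
    cases L with
    | nil => simp at h
    | cons a L =>
      simp at h
      obtain ⟨rfl, h⟩ := h
      induction K using List.reverseRecOn with
      | nil =>
        have : (L ++ [nm A]) ++ [nm B] = M ++ [q] := by simpa using h
        have := (List.append_inj' this rfl).2
        simp at this
      | append_singleton K b _ =>
        have : (L ++ nm A :: nm B :: K) ++ [b] = M ++ [q] := by simpa using h
        have := (List.append_inj' this rfl).2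
        simp at this
        subst this
        exact ⟨L ++ nm Z :: K, by simp⟩

theorem tight_circC {L K : List (Sym P)} {X : Fm P} (hX : ∃ C, X = circ C)
    (hL : L ≠ []) (hK : K ≠ [])
    (h : Tight (L ++ K) X) : Tight (K ++ L) X := by
  rcases h with ⟨G, T, h⟩ | ⟨_, M, h⟩
  · rcases List.append_eq_append_iff.1 h with ⟨a, rfl, rfl⟩ | ⟨a, rfl, h2⟩
    · exact Or.inl ⟨a, T ++ L, by simp⟩
    · rcases a with _ | ⟨a1, _ | ⟨a2, a⟩⟩
      · simp at h2
        subst h2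
        exact Or.inl ⟨[], T ++ G, by simp⟩
      · simp at h2
        obtain ⟨rfl, rfl⟩ := h2
        exact Or.inr ⟨hX, T ++ G, by simp⟩
      · simp at h2
        obtain ⟨rfl, rfl, rfl⟩ := h2
        exact Or.inl ⟨K ++ G, a, by simp⟩
  · left
    cases L with
    | nil => simp at hL
    | cons a L =>
      induction K using List.reverseRecOn with
      | nil => simp at hK
      | append_singleton K b _ =>
        have : (a :: L ++ K) ++ [b] = (r :: M) ++ [q] := by simpa using h
        have h1 := (List.append_inj' this rfl).2
        have h2 := (List.append_inj' this rfl).1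
        simp at h1 h2
        obtain ⟨rfl, rfl⟩ := h2
        subst h1
        exact ⟨K, L, by simp⟩

theorem main {p : P} {N : ℕ} {B : Fm P} {c : Bool} {S : List (Fm P)} {X : Fm P}
    (h : Dv P c S X) : c = false → ∀ L : List (Sym P), S = L.map (ev p N B) →
    nq L = 1 → nr L = 1 → size L + sz X + sz B ≤ N →
    ∃ I, Dv P true [B] I ∧ Dv P true (L.flatMap (rho I)) X ∧ sz I ≤ size L + sz X ∧
      (¬ Tight L X → sz I < size L + sz X) := by
  induction h with
  | ax c A =>
    intro _ L hL hq hr hs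
    obtain ⟨s, L', rfl, h1, h2⟩ := List.map_eq_cons_iff.1 hL.symm
    obtain rfl := List.map_eq_nil_iff.1 h2
    cases s <;> simp [q1, r1] at hq hr
  | ldivL c Γ Δ Pi A B' C h1 h2 hne ih1 ih2 =>
    intro hc L hL hq hr hs
    obtain ⟨L12, L3', rfl, h3, h4⟩ := List.map_eq_append_iff.1 hL.symm
    obtain ⟨L1, L2, rfl, rfl, rfl⟩ := List.map_eq_append_iff.1 h3
    obtain ⟨s, L3, rfl, h5, rfl⟩ := List.map_eq_cons_iff.1 h4
    cases s with
    | q => simp [ev] at h5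
    | r =>
      simp only [ev, Fm.ldiv.injEq] at h5
      obtain ⟨rfl, rfl⟩ := h5
      simp [q1, r1, s1] at hq hr hs
      have hb := balD h2 (by omega) (by omega)
      have h6 := (only_q h2 hc L2 rfl (by omega) (by omega) (by omega)).2 rfl
      subst h6
      simp [q1] at hq
      obtain ⟨I, g1, g2, g3⟩ := resid B _ _ _ (to_true h1)
      have p1 := plain p N B I L1 (by omega) (by omega)
      have p3 := plain p N B I L3 (by omega) (by omega)
      rw [p1.2, p3.2] at g3
      refine ⟨I, g1, ?_, ?_, ?_⟩
      · simpa [rho, p1.1, p3.1] using g2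
      · simp [s1]; omega
      · intro ht
        exact absurd (Or.inl ⟨L1, L3, by simp⟩) ht
    | nm F =>
      simp only [ev] at h5; subst h5
      simp [q1, r1, s1, sz] at hq hr hs
      have hb := bal h2 (by omega) (by omega) (by omega)
      have hA := sz_pos A
      have hB := sz_pos B'
      by_cases hq2 : nq L2 = 0
      · obtain ⟨I, g1, g2, g3, _⟩ := ih1 hc (L1 ++ nm B' :: L3) (by simp [ev])
          (by simp [q1]; omega) (by simp [r1]; omega) (by simp [s1]; omega)
        simp [s1] at g3
        refine ⟨I, g1, ?_, ?_, fun _ => ?_⟩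
        · have p2 := plain p N B I L2 (by omega) (by omega)
          have := Dv.ldivL true _ _ _ A B' C (by simpa [rho] using g2) (to_true h2) hne
          simpa [rho, p2.1] using this
        · simp [s1, sz]; omega
        · simp [s1, sz]; omega
      · obtain ⟨I, g1, g2, g3, _⟩ := ih2 hc L2 rfl (by omega) (by omega) (by omega)
        refine ⟨I, g1, ?_, ?_, fun _ => ?_⟩
        · have p1 := plain p N B I L1 (by omega) (by omega)
          have p3 := plain p N B I L3 (by omega) (by omega)
          have := Dv.ldivL true _ _ _ A B' C (to_true h1) g2 (dv_ne g2)
          simpa [rho, p1.1, p3.1] using this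
        · simp [s1, sz]; omega
        · simp [s1, sz]; omega
  | rdivL c Γ Δ Pi A B' C h1 h2 hne ih1 ih2 =>
    intro hc L hL hq hr hs
    obtain ⟨L1, L3', rfl, rfl, h4⟩ := List.map_eq_append_iff.1 hL.symm
    obtain ⟨s, L23, rfl, h5, h3⟩ := List.map_eq_cons_iff.1 h4
    obtain ⟨L2, L3, rfl, rfl, rfl⟩ := List.map_eq_append_iff.1 h3
    cases s with
    | q => simp [ev] at h5
    | r => simp [ev] at h5
    | nm F =>
      simp only [ev] at h5; subst h5
      simp [q1, r1, s1, sz] at hq hr hs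
      have hb := bal h2 (by omega) (by omega) (by omega)
      have hA := sz_pos A
      have hB := sz_pos B'
      by_cases hq2 : nq L2 = 0
      · obtain ⟨I, g1, g2, g3, _⟩ := ih1 hc (L1 ++ nm B' :: L3) (by simp [ev])
          (by simp [q1]; omega) (by simp [r1]; omega) (by simp [s1]; omega)
        simp [s1] at g3
        refine ⟨I, g1, ?_, ?_, fun _ => ?_⟩
        · have p2 := plain p N B I L2 (by omega) (by omega)
          have := Dv.rdivL true _ _ _ A B' C (by simpa [rho] using g2) (to_true h2) hne
          simpa [rho, p2.1] using this
        · simp [s1, sz]; omega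
        · simp [s1, sz]; omega
      · obtain ⟨I, g1, g2, g3, _⟩ := ih2 hc L2 rfl (by omega) (by omega) (by omega)
        refine ⟨I, g1, ?_, ?_, fun _ => ?_⟩
        · have p1 := plain p N B I L1 (by omega) (by omega)
          have p3 := plain p N B I L3 (by omega) (by omega)
          have := Dv.rdivL true _ _ _ A B' C (to_true h1) g2 (dv_ne g2)
          simpa [rho, p1.1, p3.1] using this
        · simp [s1, sz]; omega
        · simp [s1, sz]; omega
  | ldivR c Pi A B' h1 hne ih =>
    intro hc L hL hq hr hs
    simp [sz] at hs
    obtain ⟨I, g1, g2, g3, g4⟩ := ih hc (nm A :: L) (by simp [ev, hL])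
      (by simp [q1]; omega) (by simp [r1]; omega) (by simp [s1]; omega)
    simp [s1] at g3 g4
    refine ⟨I, g1, ?_, by simp [sz]; omega, fun ht => ?_⟩
    · refine Dv.ldivR _ _ _ _ (by simpa [rho] using g2) ?_
      intro h0
      have : r ∈ L := by
        by_contra hn
        have : nr L = 0 := by
          unfold nr
          apply List.sum_eq_zero
          intro x hx
          obtain ⟨s, hs, rfl⟩ := List.mem_map.1 hx
          cases s <;> simp_all [r1]
        omega
      have h7 := List.flatMap_eq_nil_iff.1 h0 r this
      simp [rho] at h7
    · have := g4 (fun h => ht (tight_ldivR h))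
      simp [sz]; omega
  | rdivR c Pi A B' h1 hne ih =>
    intro hc L hL hq hr hs
    simp [sz] at hs
    obtain ⟨I, g1, g2, g3, g4⟩ := ih hc (L ++ [nm A]) (by simp [ev, hL])
      (by simp [q1]; omega) (by simp [r1]; omega) (by simp [s1]; omega)
    simp [s1] at g3 g4
    refine ⟨I, g1, ?_, by simp [sz]; omega, fun ht => ?_⟩
    · refine Dv.rdivR _ _ _ _ (by simpa [rho] using g2) ?_
      intro h0
      have : r ∈ L := by
        by_contra hn
        have : nr L = 0 := by
          unfold nr
          apply List.sum_eq_zero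
          intro x hx
          obtain ⟨s, hs, rfl⟩ := List.mem_map.1 hx
          cases s <;> simp_all [r1]
        omega
      have h7 := List.flatMap_eq_nil_iff.1 h0 r this
      simp [rho] at h7
    · have := g4 (fun h => ht (tight_rdivR h))
      simp [sz]; omega
  | mulL c Γ Δ A B' C h1 ih =>
    intro hc L hL hq hr hs
    obtain ⟨L1, L3', rfl, rfl, h4⟩ := List.map_eq_append_iff.1 hL.symm
    obtain ⟨s, L3, rfl, h5, rfl⟩ := List.map_eq_cons_iff.1 h4
    cases s with
    | q => simp [ev] at h5
    | r => simp [ev] at h5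
    | nm F =>
      simp only [ev] at h5; subst h5
      simp [q1, r1, s1, sz] at hq hr hs
      obtain ⟨I, g1, g2, g3, g4⟩ := ih hc (L1 ++ nm A :: nm B' :: L3) (by simp [ev])
        (by simp [q1]; omega) (by simp [r1]; omega) (by simp [s1]; omega)
      simp [s1] at g3 g4
      refine ⟨I, g1, ?_, by simp [s1, sz]; omega, fun ht => ?_⟩
      · have := Dv.mulL true _ _ A B' C (by simpa [rho] using g2)
        simpa [rho] using this
      · have := g4 (fun h => ht (tight_mulL _ h))
        simp [s1, sz]; omega
  | mulR c Pi Psi A B' h1 h2 hn1 hn2 ih1 ih2 =>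
    intro hc L hL hq hr hs
    obtain ⟨L1, L2, rfl, rfl, rfl⟩ := List.map_eq_append_iff.1 hL.symm
    simp [sz] at hq hr hs
    have hb := bal h1 (by omega) (by omega) (by omega)
    have hA := sz_pos A
    have hB := sz_pos B'
    by_cases hq2 : nq L1 = 0
    · obtain ⟨I, g1, g2, g3, _⟩ := ih2 hc L2 rfl (by omega) (by omega) (by omega)
      refine ⟨I, g1, ?_, by simp [sz]; omega, fun _ => by simp [sz]; omega⟩
      have p1 := plain p N B I L1 (by omega) (by omega)
      have := Dv.mulR true _ _ A B' (to_true h1) g2 hn1 (dv_ne g2)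
      simpa [p1.1] using this
    · obtain ⟨I, g1, g2, g3, _⟩ := ih1 hc L1 rfl (by omega) (by omega) (by omega)
      refine ⟨I, g1, ?_, by simp [sz]; omega, fun _ => by simp [sz]; omega⟩
      have p2 := plain p N B I L2 (by omega) (by omega)
      have := Dv.mulR true _ _ A B' g2 (to_true h2) (dv_ne g2) hn2
      simpa [p2.1] using this
  | circR c Pi A h1 ih =>
    intro hc L hL hq hr hs
    obtain ⟨I, g1, g2, g3, g4⟩ := ih hc L hL hq hr hs
    refine ⟨I, g1, Dv.circR _ _ _ g2, g3, fun ht => g4 (fun h => ht ?_)⟩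
    rcases h with h | ⟨_, h⟩
    · exact Or.inl h
    · exact Or.inr ⟨⟨A, rfl⟩, h⟩
  | circL c A B' h1 ih =>
    intro hc L hL hq hr hs
    obtain ⟨s, L', rfl, h1, h2⟩ := List.map_eq_cons_iff.1 hL.symm
    obtain rfl := List.map_eq_nil_iff.1 h2
    cases s <;> simp [q1, r1] at hq hr
  | circC c Pi Psi A h1 hn1 hn2 ih =>
    intro hc L hL hq hr hs
    obtain ⟨L1, L2, rfl, rfl, rfl⟩ := List.map_eq_append_iff.1 hL.symm
    simp at hq hr hs hn1 hn2
    obtain ⟨I, g1, g2, g3, g4⟩ := ih hc (L2 ++ L1) (by simp) (by simp; omega) (by simp; omega)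
      (by simp; omega)
    simp at g3 g4
    refine ⟨I, g1, ?_, by simp; omega, fun ht => ?_⟩
    · simp only [List.flatMap_append] at g2 ⊢
      by_cases e1 : L1.flatMap (rho I) = []
      · rw [e1] at g2 ⊢; simpa using g2
      by_cases e2 : L2.flatMap (rho I) = []
      · rw [e2] at g2 ⊢; simpa using g2
      exact Dv.circC _ _ _ _ g2 e2 e1
    · have := g4 (fun h => ht (tight_circC ⟨A, rfl⟩ hn1 hn2 h))
      simp; omega
  | cut => intro hc; simp at hc

theorem cyc_circ (n : ℕ) : ∀ B : Fm P, sz B ≤ n →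
    (∀ Γ Δ : List (Fm P), Dv P true (Γ ++ Δ) B → Dv P true (Δ ++ Γ) B) →
    Dv P true [circ B] B := by
  induction n with
  | zero => intro B h; have := sz_pos B; omega
  | succ n ih =>
    intro B hB hcyc
    by_cases hX : ∃ C, B = circ C
    · obtain ⟨C, rfl⟩ := hX
      exact Dv.circL _ _ _ (Dv.ax _ _)
    have h0 : Dv P true ([circ (pw (atom B) (2 * sz B))] ++
        [ldiv (circ (pw (atom B) (2 * sz B))) B]) B :=
      Dv.ldivL true [] [] [_] _ B B (Dv.ax _ _) (Dv.ax _ _) (by simp)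
    have h1 := cut_elim (hcyc _ _ h0)
    obtain ⟨I, g1, g2, _, g4⟩ := main (p := atom B) (N := 2 * sz B) (B := B) h1 rfl [r, q]
      (by simp [ev]) (by simp [q1]) (by simp [r1]) (by simp [s1]; omega)
    have g5 := g4 (by
      rintro (⟨G, T, h⟩ | ⟨h, _⟩)
      · rcases G with _ | ⟨a, _ | ⟨b, G⟩⟩ <;> simp at h
      · exact hX h)
    simp [s1] at g5
    have g6 : Dv P true [I] B := by simpa [rho] using g2
    have hI := ih I (by omega) (by
      intro Γ Δ h
      have h2 := Dv.cut [] [] _ _ _ h g6 (dv_ne h)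
      have h3 := hcyc Γ Δ (by simpa using h2)
      have h4 := Dv.cut [] [] _ _ _ h3 g1 (dv_ne h3)
      simpa using h4)
    have k1 : Dv P true [circ B] (circ I) := Dv.circL _ _ _ (Dv.circR _ _ _ g1)
    have k2 : Dv P true [circ B] I := by
      simpa using Dv.cut [] [] _ _ _ k1 hI (by simp)
    simpa using Dv.cut [] [] _ _ _ k2 g6 (by simp)

end CircProof

/-- If `A → B` is derivable in `L^∘` and the right-hand side `B` is closed
under cyclic shifts of antecedents (for all sequences `Γ`, `Δ`, if `Γ,Δ → B`
is derivable in `L^∘` then so is `Δ,Γ → B`), then `A^∘ → B` is derivable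
in `L^∘`. -/
theorem circ_intro_of_cyclic_succedent (P : Type) (A B : Fm P)
    (hAB : Dv P true [A] B)
    (hcyc : ∀ Γ Δ : List (Fm P), Dv P true (Γ ++ Δ) B → Dv P true (Δ ++ Γ) B) :
    Dv P true [Fm.circ A] B := by
  have h1 := CircProof.cyc_circ _ B le_rfl hcyc
  have k1 : Dv P true [Fm.circ A] (Fm.circ B) := Dv.circL _ _ _ (Dv.circR _ _ _ hAB)
  simpa using Dv.cut [] [] _ _ _ k1 h1 (by simp)
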